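/- Let n = 2r be an even integer with n ≥ 4 and let F be a field of arbitrary characteristic. Then the family of elements [T] of F[V], indexed by the symplectic standard even-tableaux T, is linearly independent over F; in particular the map T ↦ [T] from symplectic standard even-tableaux to F[V] is injective. -/

import Mathlib

open scoped Matrix

noncomputable section

namespace PR

/-- The polynomial ring `R[Y_{ij} : 1 ≤ i, j ≤ n]`, `n = 2r`. -/
abbrev PolyRing (r : ℕ) (R : Type*) [CommRing R] :=
  MvPolynomial (Fin (2 * r) × Fin (2 * r)) R

/-- The standard symplectic form matrix `J` (`n = 2r`). -/
def Jmat (r : ℕ) (R : Type*) [CommRing R] : Matrix (Fin (2 * r)) (Fin (2 * r)) R :=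
  Matrix.of fun i j =>
    if (j : ℕ) = (i : ℕ) + r then 1 else if (i : ℕ) = (j : ℕ) + r then -1 else 0

/-- The generic `n × n` matrix of indeterminates. -/
def Ygen (r : ℕ) (R : Type*) [CommRing R] :
    Matrix (Fin (2 * r)) (Fin (2 * r)) (MvPolynomial (Fin (2 * r) × Fin (2 * r)) R) :=
  Matrix.of fun i j => MvPolynomial.X (i, j)

/-- The defining ideal of the scheme `V`. -/
def VIdeal (r : ℕ) (R : Type*) [CommRing R] :
    Ideal (MvPolynomial (Fin (2 * r) × Fin (2 * r)) R) :=
  Ideal.span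
    ({p | ∃ i j, p = (Ygen r R + (Ygen r R)ᵀ) i j} ∪
     {p | ∃ i, p = Ygen r R i i} ∪
     {p | ∃ i j, p = ((Ygen r R)ᵀ * Jmat r (PolyRing r R) * Ygen r R) i j} ∪
     {p | ∃ k, p = (Matrix.charpoly (-(Jmat r (PolyRing r R) * Ygen r R)) - Polynomial.X ^ (2 * r)).coeff k})

/-- The coordinate ring `R[V]`. -/
abbrev FV (r : ℕ) (R : Type*) [CommRing R] :=
  MvPolynomial (Fin (2 * r) × Fin (2 * r)) R ⧸ VIdeal r R

/-- The pfaffian of an `m × m` matrix (nonzero only for even `m`), defined as a signed sum over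
permutations `σ` with `σ(2i-1) < σ(2i)` for each pair and `σ(1) < σ(3) < ⋯` (here 0-indexed). -/
def pf {m : ℕ} {R : Type*} [CommRing R] (A : Matrix (Fin m) (Fin m) R) : R :=
  ∑ σ ∈ Finset.univ.filter (fun σ : Equiv.Perm (Fin m) =>
      (∀ i : Fin (m / 2),
        σ ⟨2 * i.val, by have := i.isLt; omega⟩ < σ ⟨2 * i.val + 1, by have := i.isLt; omega⟩) ∧
      ∀ i j : Fin (m / 2), i < j →
        σ ⟨2 * i.val, by have := i.isLt; omega⟩ < σ ⟨2 * j.val, by have := j.isLt; omega⟩),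
    (Equiv.Perm.sign σ : ℤ) •
      ∏ i : Fin (m / 2),
        A (σ ⟨2 * i.val, by have := i.isLt; omega⟩) (σ ⟨2 * i.val + 1, by have := i.isLt; omega⟩)

/-- `[i₁, …, i₂ₗ]`: the pfaffian of the submatrix of `Y` given by a list of indices. -/
def listPf {n : ℕ} {R : Type*} [CommRing R] (Y : Matrix (Fin n) (Fin n) R)
    (L : List (Fin n)) : R :=
  pf (Matrix.of fun a b : Fin L.length => Y (L.get a) (L.get b))

/-- The product of pfaffians associated to a tableau (rows as lists of entries),
as a polynomial. -/
def tabPoly (r : ℕ) (R : Type*) [CommRing R] (T : List (List (Fin (2 * r)))) :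
    MvPolynomial (Fin (2 * r) × Fin (2 * r)) R :=
  (T.map (listPf (Ygen r R))).prod

/-- `[T]`, the class of the product of pfaffians of the rows of `T` in `R[V]`. -/
def tabElem (r : ℕ) (R : Type*) [CommRing R] (T : List (List (Fin (2 * r)))) : FV r R :=
  Ideal.Quotient.mk (VIdeal r R) (tabPoly r R T)

/-- Position of an index in the order `1̄ ≺ 1 ≺ 2̄ ≺ 2 ≺ ⋯ ≺ r̄ ≺ r`, where `ī := r + i`
(0-indexed: `ī` is `r + i - 1` and `i` is `i - 1`). -/
def ordIdx (r : ℕ) (x : Fin (2 * r)) : ℕ :=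
  if x.val < r then 2 * x.val + 1 else 2 * (x.val - r)

/-- A list of rows represents a tableau of shape a partition: row lengths weakly decreasing
and positive. -/
def IsShape {α : Type*} (T : List (List α)) : Prop :=
  (T.map List.length).Chain' (fun a b => b ≤ a) ∧ ∀ row ∈ T, row ≠ []

/-- An even-tableau: every row has even length. -/
def IsEvenTab {α : Type*} (T : List (List α)) : Prop :=
  ∀ row ∈ T, Even row.length

/-- Standard: entries strictly increase along each row and weakly increase down each column,
with respect to the order `≺`. -/
def IsStandard (r : ℕ) (T : List (List (Fin (2 * r)))) : Prop :=
  (∀ row ∈ T, row.Chain' (fun a b => ordIdx r a < ordIdx r b)) ∧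
  ∀ (i t : ℕ) (hi : i + 1 < T.length) (ht' : t < (T[i]'(Nat.lt_of_succ_lt hi)).length)
    (ht : t < (T[i + 1]'hi).length),
    ordIdx r ((T[i]'(Nat.lt_of_succ_lt hi))[t]'ht') ≤ ordIdx r ((T[i + 1]'hi)[t]'ht)

/-- The symplectic condition: the entries `p` and `p̄` (0-indexed: values `p` and `r + p`
for `p < r`) occur only in the first `p + 1` columns (0-indexed: columns `t ≤ p`). -/
def IsSymplectic (r : ℕ) (T : List (List (Fin (2 * r)))) : Prop :=
  ∀ (i t : ℕ) (hi : i < T.length) (ht : t < (T[i]'hi).length) (p : ℕ), p < r →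
    (((T[i]'hi)[t]'ht).val = p ∨ ((T[i]'hi)[t]'ht).val = r + p) → t ≤ p

/-- A symplectic standard even-tableau. -/
def IsSSET (r : ℕ) (T : List (List (Fin (2 * r)))) : Prop :=
  IsShape T ∧ IsEvenTab T ∧ IsStandard r T ∧ IsSymplectic r T

/-- A canonical tableau: in column `j` only `j̄` appears (0-indexed: column `t` contains
only the value `r + t`). -/
def IsCanonical (r : ℕ) (T : List (List (Fin (2 * r)))) : Prop :=
  ∀ (i t : ℕ) (hi : i < T.length) (ht : t < (T[i]'hi).length), ((T[i]'hi)[t]'ht).val = r + t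

/-- The set `V(C)` of matrices. -/
def MemV (r : ℕ) {C : Type*} [CommRing C] (Y : Matrix (Fin (2 * r)) (Fin (2 * r)) C) : Prop :=
  Y = -Yᵀ ∧ (∀ i, Y i i = 0) ∧ Yᵀ * Jmat r C * Y = 0 ∧
    Matrix.charpoly (-(Jmat r C * Y)) = Polynomial.X ^ (2 * r)

/-- The embedding `i ↦ i` of `{1, …, r}` into `{1, …, n}`. -/
def emb (r : ℕ) (i : Fin r) : Fin (2 * r) := ⟨i.val, by have := i.isLt; omega⟩

/-- The embedding `i ↦ ī = r + i` of `{1, …, r}` into `{1, …, n}`. -/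
def embBar (r : ℕ) (i : Fin r) : Fin (2 * r) := ⟨r + i.val, by have := i.isLt; omega⟩

/-- The index list of `[P, Q̄]`: with `Γ₀ = P ∩ Q = {γ₁ < ⋯ < γ_λ}`, the list
`γ₁, γ̄₁, …, γ_λ, γ̄_λ` followed by `P ∖ Γ₀` in increasing order and then the bars of
`Q ∖ Γ₀` in increasing order. -/
def pqList (r : ℕ) (P Q : Finset (Fin r)) : List (Fin (2 * r)) :=
  ((P ∩ Q).sort (· ≤ ·)).flatMap (fun γ => [emb r γ, embBar r γ]) ++
    ((P \ Q).sort (· ≤ ·)).map (emb r) ++ ((Q \ P).sort (· ≤ ·)).map (embBar r)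

/-- The pfaffian `[P, Q̄]` of the matrix `Y`. -/
def pfPQ (r : ℕ) {C : Type*} [CommRing C] (Y : Matrix (Fin (2 * r)) (Fin (2 * r)) C)
    (P Q : Finset (Fin r)) : C :=
  listPf Y (pqList r P Q)

/-- The defining ideal of the scheme `W`. -/
def WIdeal (r : ℕ) (R : Type*) [CommRing R] : Ideal (PolyRing r R) :=
  Ideal.span
    ({p | ∃ i j, p = (Jmat r (PolyRing r R) * (Ygen r R)ᵀ * Jmat r (PolyRing r R)
            + Ygen r R) i j} ∪
     {p | ∃ i j, p = (Ygen r R * Ygen r R) i j} ∪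
     {p | ∃ k, p = (Matrix.charpoly (Ygen r R) - Polynomial.X ^ (2 * r)).coeff k})

/-- The coordinate ring `R[W]`. -/
abbrev FW (r : ℕ) (R : Type*) [CommRing R] := PolyRing r R ⧸ WIdeal r R


section Pfaffian

variable {m : ℕ}

/-- The index `2i + b` of `Fin m`, for `m` even, as a function of the pair number `i` and of
`b ∈ {0, 1}`. -/
def pairEquiv (hm : m / 2 * 2 = m) : Fin (m / 2) × Fin 2 ≃ Fin m :=
  finProdFinEquiv.trans (finCongr hm)

lemma pairEquiv_val (hm : m / 2 * 2 = m) (i : Fin (m / 2)) (b : Fin 2) :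
    (pairEquiv hm (i, b)).val = b.val + 2 * i.val := by
  simp [pairEquiv]

/-- The permutations over which the sum defining `pf` ranges. -/
def IsPairSorted (hm : m / 2 * 2 = m) (σ : Equiv.Perm (Fin m)) : Prop :=
  (∀ i, σ (pairEquiv hm (i, 0)) < σ (pairEquiv hm (i, 1))) ∧
    StrictMono fun i => σ (pairEquiv hm (i, 0))

lemma mk_two_mul_eq_pairEquiv (hm : m / 2 * 2 = m) (i : Fin (m / 2)) (h : 2 * i.val < m) :
    (⟨2 * i.val, h⟩ : Fin m) = pairEquiv hm (i, 0) :=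
  Fin.ext (by simp [pairEquiv_val])

lemma mk_two_mul_add_one_eq_pairEquiv (hm : m / 2 * 2 = m) (i : Fin (m / 2))
    (h : 2 * i.val + 1 < m) : (⟨2 * i.val + 1, h⟩ : Fin m) = pairEquiv hm (i, 1) :=
  Fin.ext (by simp [pairEquiv_val, add_comm])

open Classical in
lemma pf_eq_sum_isPairSorted {R : Type*} [CommRing R] (hm : m / 2 * 2 = m)
    (A : Matrix (Fin m) (Fin m) R) :
    pf A = ∑ σ with IsPairSorted hm σ, (Equiv.Perm.sign σ : ℤ) •
      ∏ i, A (σ (pairEquiv hm (i, 0))) (σ (pairEquiv hm (i, 1))) := by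
  unfold pf
  simp only [mk_two_mul_eq_pairEquiv hm, mk_two_mul_add_one_eq_pairEquiv hm]
  refine Finset.sum_congr ?_ fun _ _ => rfl
  ext σ
  rw [Finset.mem_filter, Finset.mem_filter]
  rfl

/-- The permutation of `Fin m` which permutes the pairs by `π` and then flips them by `ε`. -/
def pairPerm (hm : m / 2 * 2 = m)
    (g : Equiv.Perm (Fin (m / 2)) × (Fin (m / 2) → Equiv.Perm (Fin 2))) :
    Equiv.Perm (Fin m) :=
  (pairEquiv hm).permCongr (Equiv.prodCongrRight g.2 * Equiv.prodCongrLeft fun _ => g.1)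

lemma pairPerm_apply (hm : m / 2 * 2 = m)
    (g : Equiv.Perm (Fin (m / 2)) × (Fin (m / 2) → Equiv.Perm (Fin 2))) (i : Fin (m / 2))
    (b : Fin 2) :
    pairPerm hm g (pairEquiv hm (i, b)) = pairEquiv hm (g.1 i, g.2 (g.1 i) b) := by
  simp [pairPerm, Equiv.permCongr_apply]

lemma sign_pairPerm (hm : m / 2 * 2 = m)
    (g : Equiv.Perm (Fin (m / 2)) × (Fin (m / 2) → Equiv.Perm (Fin 2))) :
    Equiv.Perm.sign (pairPerm hm g) = ∏ i, Equiv.Perm.sign (g.2 i) := by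
  rw [pairPerm, Equiv.Perm.sign_permCongr, Equiv.Perm.sign_mul, Equiv.Perm.sign_prodCongrRight,
    Equiv.Perm.sign_prodCongrLeft]
  simp [sq]

lemma perm_fin_two_eq (e : Equiv.Perm (Fin 2)) : e = 1 ∨ e = Equiv.swap 0 1 := by
  revert e; decide

/-- The signed product over consecutive pairs attached to a permutation. -/
def pfTerm {R : Type*} [CommRing R] (hm : m / 2 * 2 = m) (A : Matrix (Fin m) (Fin m) R)
    (σ : Equiv.Perm (Fin m)) : R :=
  (Equiv.Perm.sign σ : ℤ) • ∏ i, A (σ (pairEquiv hm (i, 0))) (σ (pairEquiv hm (i, 1)))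

lemma pfTerm_mul_pairPerm {R : Type*} [CommRing R] (hm : m / 2 * 2 = m)
    (A : Matrix (Fin m) (Fin m) R) (hA : ∀ i j, A i j = -A j i) (σ : Equiv.Perm (Fin m))
    (g : Equiv.Perm (Fin (m / 2)) × (Fin (m / 2) → Equiv.Perm (Fin 2))) :
    pfTerm hm A (σ * pairPerm hm g) = pfTerm hm A σ := by
  have key (i : Fin (m / 2)) (e : Equiv.Perm (Fin 2)) :
      A (σ (pairEquiv hm (i, e 0))) (σ (pairEquiv hm (i, e 1))) =
        ((Equiv.Perm.sign e : ℤ) : R) *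
          A (σ (pairEquiv hm (i, 0))) (σ (pairEquiv hm (i, 1))) := by
    rcases perm_fin_two_eq e with rfl | rfl
    · simp
    · rw [Equiv.swap_apply_left, Equiv.swap_apply_right, hA, Equiv.Perm.sign_swap (by decide)]
      simp
  unfold pfTerm
  simp only [Equiv.Perm.mul_apply, pairPerm_apply]
  rw [Equiv.prod_comp g.1 fun j => A (σ (pairEquiv hm (j, g.2 j 0))) (σ (pairEquiv hm (j, g.2 j 1)))]
  simp only [key, Finset.prod_mul_distrib, map_mul, sign_pairPerm, zsmul_eq_mul]
  rw [← mul_assoc]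
  congr 1
  push_cast
  rw [mul_assoc, ← Finset.prod_mul_distrib]
  simp [← Int.cast_mul, ← Units.val_mul]

lemma exists_mul_pairPerm_isPairSorted (hm : m / 2 * 2 = m) (σ : Equiv.Perm (Fin m)) :
    ∃ g, IsPairSorted hm (σ * pairPerm hm g) := by
  classical
  let ε : Fin (m / 2) → Equiv.Perm (Fin 2) := fun i =>
    if σ (pairEquiv hm (i, 0)) < σ (pairEquiv hm (i, 1)) then 1 else Equiv.swap 0 1
  let f : Fin (m / 2) → Fin m := fun i => σ (pairEquiv hm (i, ε i 0))
  have hf : Function.Injective f := fun i j hij => by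
    simpa using congrArg Prod.fst ((pairEquiv hm).injective (σ.injective hij))
  refine ⟨(Tuple.sort f, ε), fun i => ?_, ?_⟩
  · simp only [Equiv.Perm.mul_apply, pairPerm_apply]
    generalize Tuple.sort f i = j
    by_cases h : σ (pairEquiv hm (j, 0)) < σ (pairEquiv hm (j, 1))
    · simp [ε, h]
    · simp only [ε, h, if_false, Equiv.swap_apply_left, Equiv.swap_apply_right]
      refine lt_of_le_of_ne (not_lt.mp h) fun h' => ?_
      simpa using (pairEquiv hm).injective (σ.injective h')
  · simp only [Equiv.Perm.mul_apply, pairPerm_apply]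
    exact (Tuple.monotone_sort f).strictMono_of_injective
      (hf.comp (Tuple.sort f).injective)

lemma pairPerm_inv (hm : m / 2 * 2 = m)
    (g : Equiv.Perm (Fin (m / 2)) × (Fin (m / 2) → Equiv.Perm (Fin 2))) :
    (pairPerm hm g)⁻¹ = pairPerm hm (g.1⁻¹, fun i => (g.2 (g.1 i))⁻¹) := by
  rw [inv_eq_iff_mul_eq_one]
  ext x
  obtain ⟨⟨i, b⟩, rfl⟩ := (pairEquiv hm).surjective x
  simp [pairPerm_apply]

lemma mul_pairPerm_injective (hm : m / 2 * 2 = m) {σ τ : Equiv.Perm (Fin m)}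
    (hσ : IsPairSorted hm σ) (hτ : IsPairSorted hm τ)
    {g h : Equiv.Perm (Fin (m / 2)) × (Fin (m / 2) → Equiv.Perm (Fin 2))}
    (e : σ * pairPerm hm g = τ * pairPerm hm h) : σ = τ ∧ g = h := by
  have e1 (i : Fin (m / 2)) (b : Fin 2) :
      σ (pairEquiv hm (g.1 i, g.2 (g.1 i) b)) = τ (pairEquiv hm (h.1 i, h.2 (h.1 i) b)) := by
    simpa [pairPerm_apply] using congrArg (fun p => p (pairEquiv hm (i, b))) e
  have e2 (i : Fin (m / 2)) : g.2 (g.1 i) = h.2 (h.1 i) := by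
    have h0 := e1 i 0
    have h1 := e1 i 1
    have a1 := hσ.1 (g.1 i)
    have a2 := hτ.1 (h.1 i)
    rcases perm_fin_two_eq (g.2 (g.1 i)) with hg | hg <;>
      rcases perm_fin_two_eq (h.2 (h.1 i)) with hh | hh <;>
      simp only [hg, hh, Equiv.Perm.one_apply, Equiv.swap_apply_left,
        Equiv.swap_apply_right] at h0 h1 ⊢
    · rw [h0, h1] at a1
      exact absurd a1 a2.asymm
    · rw [h0, h1] at a1
      exact absurd a1 a2.asymm
  have e3 (i : Fin (m / 2)) (b : Fin 2) :
      σ (pairEquiv hm (g.1 i, b)) = τ (pairEquiv hm (h.1 i, b)) := by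
    have := e1 i ((g.2 (g.1 i))⁻¹ b)
    rw [← e2] at this
    simpa using this
  have e4 : (fun i => σ (pairEquiv hm (i, 0))) = fun i => τ (pairEquiv hm (i, 0)) := by
    refine (StrictMono.range_inj hσ.2 hτ.2).mp ?_
    rw [← g.1.surjective.range_comp, ← h.1.surjective.range_comp fun i => τ (pairEquiv hm (i, 0))]
    exact congrArg Set.range (funext fun i => e3 i 0)
  have e5 : g.1 = h.1 := by
    ext1 i
    have := (congrFun e4 (g.1 i)).symm.trans (e3 i 0)
    simpa using congrArg Prod.fst ((pairEquiv hm).injective (τ.injective this))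
  refine ⟨?_, Prod.ext e5 ?_⟩
  · ext1 x
    obtain ⟨⟨i, b⟩, rfl⟩ := (pairEquiv hm).surjective x
    obtain ⟨i, rfl⟩ := g.1.surjective i
    rw [e3, e5]
  · funext i
    obtain ⟨i, rfl⟩ := g.1.surjective i
    rw [e2, e5]

lemma card_smul_pf_eq_sum {R : Type*} [CommRing R] (hm : m / 2 * 2 = m)
    (A : Matrix (Fin m) (Fin m) R) (hA : ∀ i j, A i j = -A j i) :
    Fintype.card (Equiv.Perm (Fin (m / 2)) × (Fin (m / 2) → Equiv.Perm (Fin 2))) • pf A =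
      ∑ σ, pfTerm hm A σ := by
  classical
  have h1 : ∑ σ, pfTerm hm A σ =
      ∑ x ∈ (Finset.univ.filter (IsPairSorted hm)) ×ˢ (Finset.univ : Finset
        (Equiv.Perm (Fin (m / 2)) × (Fin (m / 2) → Equiv.Perm (Fin 2)))), pfTerm hm A x.1 := by
    symm
    refine Finset.sum_bij (fun x _ => x.1 * pairPerm hm x.2) (fun _ _ => Finset.mem_univ _)
      ?_ ?_ fun x _ => (pfTerm_mul_pairPerm hm A hA _ _).symm
    · rintro ⟨σ, g⟩ h1 ⟨τ, h⟩ h2 e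
      simp only [Finset.mem_product, Finset.mem_filter, Finset.mem_univ, true_and,
        and_true] at h1 h2
      obtain ⟨rfl, rfl⟩ := mul_pairPerm_injective hm h1 h2 e
      rfl
    · intro σ _
      obtain ⟨g, hg⟩ := exists_mul_pairPerm_isPairSorted hm σ
      refine ⟨(σ * pairPerm hm g, (g.1⁻¹, fun i => (g.2 (g.1 i))⁻¹)), by simpa using hg, ?_⟩
      simp [← pairPerm_inv]
  rw [h1, Finset.sum_product, pf_eq_sum_isPairSorted hm, Finset.smul_sum]
  refine Finset.sum_congr rfl fun σ _ => ?_
  simp only [Finset.sum_const, Finset.card_univ]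
  rfl

lemma sum_pfTerm_mul_mul_transpose {R κ : Type*} [CommRing R] [Fintype κ]
    (hm : m / 2 * 2 = m) (B : Matrix (Fin m) κ R) (K : Matrix κ κ R) :
    ∑ σ, pfTerm hm (B * K * Bᵀ) σ =
      ∑ φ : Fin m → κ, (∏ i, K (φ (pairEquiv hm (i, 0))) (φ (pairEquiv hm (i, 1)))) *
        (B.submatrix id φ).det := by
  classical
  have h (σ : Equiv.Perm (Fin m)) :
      ∏ i, (B * K * Bᵀ) (σ (pairEquiv hm (i, 0))) (σ (pairEquiv hm (i, 1))) =
        ∑ φ : Fin m → κ, (∏ i, K (φ (pairEquiv hm (i, 0))) (φ (pairEquiv hm (i, 1)))) *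
          ∏ a, B (σ a) (φ a) := by
    have h1 (a b : Fin m) : (B * K * Bᵀ) a b =
        ∑ s : Fin 2 → κ, K (s 0) (s 1) * (B a (s 0) * B b (s 1)) := by
      rw [← (finTwoArrowEquiv κ).symm.sum_comp, Fintype.sum_prod_type_right]
      simp only [Matrix.mul_apply, Matrix.transpose_apply, Finset.sum_mul]
      refine Finset.sum_congr rfl fun t _ => Finset.sum_congr rfl fun s _ => ?_
      simp [finTwoArrowEquiv]
      ring
    simp only [h1]
    rw [Finset.prod_univ_sum, Fintype.piFinset_univ]
    rw [← ((Equiv.curry _ _ _).symm.trans ((pairEquiv hm).arrowCongr (Equiv.refl κ))).sum_comp]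
    refine Finset.sum_congr rfl fun x _ => ?_
    rw [Finset.prod_mul_distrib]
    congr 1
    · simp [Equiv.arrowCongr, Function.uncurry]
    · rw [← (pairEquiv hm).prod_comp, Fintype.prod_prod_type]
      simp [Equiv.arrowCongr, Function.uncurry]
  simp only [pfTerm, h, Finset.smul_sum]
  rw [Finset.sum_comm]
  refine Finset.sum_congr rfl fun φ _ => ?_
  rw [Matrix.det_apply, Finset.mul_sum]
  refine Finset.sum_congr rfl fun σ _ => ?_
  simp [Units.smul_def, mul_left_comm]

lemma map_pf {R S : Type*} [CommRing R] [CommRing S] (f : R →+* S)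
    (A : Matrix (Fin m) (Fin m) R) : f (pf A) = pf (A.map f) := by
  simp [pf, map_sum, map_prod]

lemma pf_smul_smul {R : Type*} [CommRing R] (hm : m / 2 * 2 = m) (c : Fin m → R)
    (A : Matrix (Fin m) (Fin m) R) :
    pf (Matrix.of fun i j => c i * c j * A i j) = (∏ i, c i) * pf A := by
  classical
  rw [pf_eq_sum_isPairSorted hm, pf_eq_sum_isPairSorted hm, Finset.mul_sum]
  refine Finset.sum_congr rfl fun σ _ => ?_
  have : ∏ i, c i = ∏ i, (c (σ (pairEquiv hm (i, 0))) * c (σ (pairEquiv hm (i, 1)))) := by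
    rw [← Equiv.prod_comp σ, ← (pairEquiv hm).prod_comp, Fintype.prod_prod_type]
    simp
  rw [this]
  simp [Finset.prod_mul_distrib, mul_left_comm]

/-- The matrix with entries `1` at `(0, 1), (2, 3), …` and zeros elsewhere. -/
def pairMatrix (k : ℕ) (R : Type*) [CommRing R] : Matrix (Fin k) (Fin k) R :=
  Matrix.of fun s t => if s.val % 2 = 0 ∧ t.val = s.val + 1 then 1 else 0

lemma pf_pairMatrix {R : Type*} [CommRing R] (hm : m / 2 * 2 = m) :
    pf (pairMatrix m R - (pairMatrix m R)ᵀ) = 1 := by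
  classical
  rw [pf_eq_sum_isPairSorted hm, Finset.sum_eq_single 1]
  · simp only [Equiv.Perm.sign_one, Units.val_one, one_smul, Equiv.Perm.one_apply]
    refine Finset.prod_eq_one fun i _ => ?_
    simp only [pairMatrix, Matrix.sub_apply, Matrix.transpose_apply, Matrix.of_apply,
      pairEquiv_val]
    rw [if_pos (by simp; omega), if_neg (by simp), sub_zero]
  · intro σ hσ hne
    simp only [Finset.mem_filter, Finset.mem_univ, true_and] at hσ
    by_contra h
    refine hne ?_
    have h1 (i : Fin (m / 2)) : (σ (pairEquiv hm (i, 0))).val % 2 = 0 ∧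
        (σ (pairEquiv hm (i, 1))).val = (σ (pairEquiv hm (i, 0))).val + 1 := by
      by_contra hi
      refine h ?_
      rw [Finset.prod_eq_zero (Finset.mem_univ i), smul_zero]
      have := hσ.1 i
      simp only [pairMatrix, Matrix.sub_apply, Matrix.transpose_apply, Matrix.of_apply]
      rw [if_neg hi, if_neg (by omega), sub_zero]
    have h2 : (fun i : Fin (m / 2) => σ (pairEquiv hm (i, 0))) =
        fun i => pairEquiv hm (i, 0) := by
      let f : Fin (m / 2) → Fin (m / 2) := fun i =>
        ⟨(σ (pairEquiv hm (i, 0))).val / 2, by have := (σ (pairEquiv hm (i, 0))).isLt; omega⟩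
      have hf : StrictMono f := fun i j hij => by
        have := hσ.2 hij
        have h3 := (h1 i).1
        have h4 := (h1 j).1
        simp only [f, Fin.lt_def] at this ⊢
        omega
      have hid : f = id := by
        refine (StrictMono.range_inj hf strictMono_id).mp ?_
        rw [(Finite.surjective_of_injective hf.injective).range_eq, Set.range_id]
      funext i
      have h3 := congrArg Fin.val (congrFun hid i)
      have h4 := (h1 i).1
      refine Fin.ext ?_
      simp only [f, id] at h3
      rw [pairEquiv_val]
      simp
      omega
    ext1 x
    obtain ⟨⟨i, b⟩, rfl⟩ := (pairEquiv hm).surjective x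
    have h3 := congrFun h2 i
    fin_cases b
    · exact h3
    · refine Fin.ext ?_
      change (σ (pairEquiv hm (i, 1))).val = (pairEquiv hm (i, 1)).val
      rw [(h1 i).2, h3, pairEquiv_val, pairEquiv_val]
      simp [add_comm]
  · intro h
    refine absurd ?_ h
    simp only [Finset.mem_filter, Finset.mem_univ, true_and]
    refine ⟨fun i => ?_, fun i j hij => ?_⟩
    · rw [Fin.lt_def, Equiv.Perm.one_apply, Equiv.Perm.one_apply, pairEquiv_val, pairEquiv_val]
      simp
    · change (pairEquiv hm (i, 0)).val < (pairEquiv hm (j, 0)).val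
      rw [pairEquiv_val, pairEquiv_val]
      simpa using hij

end Pfaffian

section Initial

open MvPolynomial

variable {σ Γ R : Type*} [CommSemiring R] [AddCommMonoid Γ] [LinearOrder Γ]

/-- The exponent `d` occurs in `p` with coefficient `1`, and every other exponent occurring in `p`
has strictly larger weight. -/
def IsInitial (W : (σ →₀ ℕ) →+ Γ) (d : σ →₀ ℕ) (p : MvPolynomial σ R) : Prop :=
  p.coeff d = 1 ∧ ∀ e ∈ p.support, e = d ∨ W d < W e

variable {W : (σ →₀ ℕ) →+ Γ}

lemma IsInitial.one : IsInitial W 0 (1 : MvPolynomial σ R) := by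
  classical
  refine ⟨by simp, fun e he => Or.inl ?_⟩
  by_contra h
  rw [mem_support_iff, coeff_one, if_neg (Ne.symm h)] at he
  exact he rfl

lemma IsInitial.le {d e : σ →₀ ℕ} {p : MvPolynomial σ R} (hp : IsInitial W d p)
    (he : e ∈ p.support) : W d ≤ W e := by
  rcases hp.2 e he with rfl | h
  · exact le_rfl
  · exact h.le

lemma IsInitial.mul [IsOrderedCancelAddMonoid Γ] {d e : σ →₀ ℕ}
    {p q : MvPolynomial σ R} (hp : IsInitial W d p)
    (hq : IsInitial W e q) : IsInitial W (d + e) (p * q) := by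
  classical
  have key (a b : σ →₀ ℕ) (ha : a ∈ p.support) (hb : b ∈ q.support) :
      (a = d ∧ b = e) ∨ W (d + e) < W (a + b) := by
    simp only [map_add]
    rcases hp.2 a ha with rfl | h
    · rcases hq.2 b hb with rfl | h'
      · exact Or.inl ⟨rfl, rfl⟩
      · exact Or.inr (add_lt_add_right h' _)
    · exact Or.inr (add_lt_add_of_lt_of_le h (hq.le hb))
  constructor
  · rw [coeff_mul, Finset.sum_eq_single (d, e), hp.1, hq.1, mul_one]
    · rintro ⟨a, b⟩ hab hne
      rw [Finset.HasAntidiagonal.mem_antidiagonal] at hab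
      by_contra h
      rcases key a b (mem_support_iff.mpr (left_ne_zero_of_mul h))
        (mem_support_iff.mpr (right_ne_zero_of_mul h)) with ⟨rfl, rfl⟩ | h'
      · exact hne rfl
      · exact h'.ne (by simp only at hab; rw [hab])
    · simp
  · intro c hc
    obtain ⟨a, ha, b, hb, rfl⟩ := Finset.mem_add.mp (support_mul p q hc)
    rcases key a b ha hb with ⟨rfl, rfl⟩ | h
    · exact Or.inl rfl
    · exact Or.inr h

lemma IsInitial.list_prod [IsOrderedCancelAddMonoid Γ] {α : Type*} (l : List α)
    (d : α → σ →₀ ℕ) (p : α → MvPolynomial σ R)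
    (h : ∀ a ∈ l, IsInitial W (d a) (p a)) :
    IsInitial W (l.map d).sum (l.map p).prod := by
  induction l with
  | nil => exact IsInitial.one
  | cons a l ih =>
    simp only [List.map_cons, List.sum_cons, List.prod_cons]
    exact (h a (by simp)).mul (ih fun b hb => h b (by simp [hb]))

lemma IsInitial.map {S : Type*} [CommSemiring S] {d : σ →₀ ℕ} {p : MvPolynomial σ R}
    (hp : IsInitial W d p) (f : R →+* S) : IsInitial W d (MvPolynomial.map f p) :=
  ⟨by rw [coeff_map, hp.1, map_one], fun e he => hp.2 e (support_map_subset f p he)⟩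

lemma linearIndependent_of_isInitial {ι F : Type*} [Field F] (p : ι → MvPolynomial σ F)
    (d : ι → σ →₀ ℕ) (hd : Function.Injective d) (h : ∀ i, IsInitial W (d i) (p i)) :
    LinearIndependent F p := by
  classical
  rw [linearIndependent_iff]
  intro c hc
  by_contra hne
  obtain ⟨i, hi, hmin⟩ := c.support.exists_min_image (fun i => W (d i))
    (Finsupp.support_nonempty_iff.mpr hne)
  have h1 := congrArg (coeff (d i)) hc
  rw [Finsupp.linearCombination_apply, Finsupp.sum, coeff_sum, Finset.sum_eq_single i] at h1
  · rw [coeff_smul, (h i).1, coeff_zero, smul_eq_mul, mul_one] at h1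
    exact Finsupp.mem_support_iff.mp hi h1
  · intro j hj hji
    rw [coeff_smul, smul_eq_mul]
    by_contra h2
    rcases (h j).2 (d i) (mem_support_iff.mpr (right_ne_zero_of_mul h2)) with h3 | h3
    · exact hji (hd h3).symm
    · exact absurd (hmin j hj) h3.not_ge
  · exact fun h' => absurd hi h'

end Initial

section Degeneration

open Polynomial

lemma linearIndependent_X_pow_mul {ι F A : Type*} [Field F] [CommRing A] [Algebra F A]
    (q : ι → A[X]) (G : ι → ℕ) (h : LinearIndependent F fun i => (q i).coeff 0) :
    LinearIndependent F fun i => X ^ G i * q i := by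
  classical
  rw [linearIndependent_iff']
  intro s c hc
  by_contra! hne
  obtain ⟨i, his, hi⟩ := hne
  obtain ⟨j, hj, hmin⟩ := (s.filter fun i => c i ≠ 0).exists_min_image G
    ⟨i, Finset.mem_filter.mpr ⟨his, hi⟩⟩
  rw [Finset.mem_filter] at hj
  have h1 := congrArg (fun f : A[X] => f.coeff (G j)) hc
  simp only [finsetSum_coeff, coeff_smul, coeff_zero, coeff_X_pow_mul'] at h1
  have h2 : ∑ i ∈ s, (if G i = G j then c i else 0) • (q i).coeff 0 = 0 := by
    rw [← h1]
    refine Finset.sum_congr rfl fun k hk => ?_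
    rcases eq_or_ne (c k) 0 with h3 | h3
    · simp [h3]
    · have := hmin k (Finset.mem_filter.mpr ⟨hk, h3⟩)
      rcases this.eq_or_lt with h4 | h4
      · simp [h4]
      · rw [if_neg h4.ne', if_neg h4.not_ge, zero_smul, smul_zero]
  have h3 := linearIndependent_iff'.mp h s _ h2 j hj.1
  rw [if_pos rfl] at h3
  exact hj.2 h3

end Degeneration

section Frame

open MvPolynomial

/-- The number (counted from `0`) of the pair `{p, p̄}` containing an index. -/
def foldIdx (r : ℕ) (i : Fin (2 * r)) : ℕ := if i.val < r then i.val else i.val - r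

/-- The matrix with entries `x (i, t)` in the columns `t` allowed by the symplectic condition in
row `i`, and zeros elsewhere. -/
def frame (r : ℕ) {R : Type*} [CommRing R] (x : Fin (2 * r) × Fin r → R) :
    Matrix (Fin (2 * r)) (Fin r) R :=
  Matrix.of fun i t => if t.val ≤ foldIdx r i then x (i, t) else 0

/-- The alternating matrix `∑ u, (m₂ᵤ m₂ᵤ₊₁ᵀ - m₂ᵤ₊₁ m₂ᵤᵀ)`, where the `mₜ` are the columns
of `M`. -/
def wedge {α : Type*} {k : ℕ} {R : Type*} [CommRing R] (M : Matrix α (Fin k) R) : Matrix α α R :=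
  M * (pairMatrix k R - (pairMatrix k R)ᵀ) * Mᵀ

lemma wedge_skew {α : Type*} {k : ℕ} {R : Type*} [CommRing R] (M : Matrix α (Fin k) R) :
    (wedge M)ᵀ = -wedge M := by
  simp [wedge, Matrix.transpose_mul, Matrix.mul_assoc, Matrix.mul_sub, Matrix.sub_mul]

lemma wedge_diag {α : Type*} {k : ℕ} {R : Type*} [CommRing R] (M : Matrix α (Fin k) R) (i : α) :
    wedge M i i = 0 := by
  have h : wedge M = M * pairMatrix k R * Mᵀ - (M * pairMatrix k R * Mᵀ)ᵀ := by
    simp [wedge, Matrix.transpose_mul, Matrix.mul_assoc, Matrix.mul_sub, Matrix.sub_mul]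
  rw [h, Matrix.sub_apply, Matrix.transpose_apply, sub_self]

lemma listPf_wedge {n k : ℕ} {R : Type*} [CommRing R] (M : Matrix (Fin n) (Fin k) R)
    (L : List (Fin n)) : listPf (wedge M) L = pf (wedge (M.submatrix L.get id)) :=
  rfl

lemma pairMatrix_map {R S : Type*} [CommRing R] [CommRing S] (k : ℕ) (f : R →+* S) :
    (pairMatrix k R).map f = pairMatrix k S := by
  ext i j
  simp [pairMatrix, apply_ite f]

lemma wedge_map {α R S : Type*} [CommRing R] [CommRing S] {k : ℕ} (f : R →+* S)
    (M : Matrix α (Fin k) R) : (wedge M).map f = wedge (M.map f) := by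
  simp only [wedge, Matrix.map_mul]
  rw [Matrix.map_sub f (map_sub f), Matrix.transpose_map, Matrix.transpose_map, pairMatrix_map]

lemma map_listPf {n : ℕ} {R S : Type*} [CommRing R] [CommRing S] (f : R →+* S)
    (Y : Matrix (Fin n) (Fin n) R) (L : List (Fin n)) :
    f (listPf Y L) = listPf (Y.map f) L :=
  map_pf f _

lemma frame_map {r : ℕ} {R S : Type*} [CommRing R] [CommRing S] (f : R →+* S)
    (x : Fin (2 * r) × Fin r → R) : (frame r x).map f = frame r (f ∘ x) := by
  ext i j
  simp [frame, apply_ite f]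

/-- The exponent of the product of the variables `x (L[t], t)`. -/
def rowExp (r : ℕ) (L : List (Fin (2 * r))) : Fin (2 * r) × Fin r →₀ ℕ :=
  Finsupp.equivFunOnFinite.symm fun p => if L[p.2.val]? = some p.1 then 1 else 0

lemma rowExp_apply (r : ℕ) (L : List (Fin (2 * r))) (i : Fin (2 * r)) (t : Fin r) :
    rowExp r L (i, t) = if L[t.val]? = some i then 1 else 0 := rfl

/-- The weight of an exponent: in lexicographic order, for each row index in the order `≺`, the
sum of the column numbers of the variables in this row. -/
def lexWeight (r : ℕ) : (Fin (2 * r) × Fin r →₀ ℕ) →+ Lex (ℕ → ℕ) :=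
  Finsupp.weight fun p : Fin (2 * r) × Fin r =>
    toLex (Pi.single (ordIdx r p.1) p.2.val : ℕ → ℕ)

/-- The conditions on a row of a symplectic standard even-tableau. -/
structure IsSympRow (r : ℕ) (L : List (Fin (2 * r))) : Prop where
  even : L.length / 2 * 2 = L.length
  lt : ∀ a b : Fin L.length, a < b → ordIdx r (L.get a) < ordIdx r (L.get b)
  le : ∀ a : Fin L.length, a.val ≤ foldIdx r (L.get a)

variable {r : ℕ} {L : List (Fin (2 * r))}

lemma foldIdx_lt (i : Fin (2 * r)) : foldIdx r i < r := by
  unfold foldIdx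
  split_ifs <;> omega

lemma IsSympRow.length_le (hL : IsSympRow r L) : L.length ≤ r := by
  by_contra! h
  exact absurd ((hL.le ⟨r, h⟩).trans_lt (foldIdx_lt _)) (lt_irrefl _)

lemma IsSympRow.get_injective (hL : IsSympRow r L) : Function.Injective L.get := by
  intro a b h
  rcases lt_trichotomy a b with h' | h' | h'
  · exact absurd (hL.lt a b h') (by rw [h]; exact lt_irrefl _)
  · exact h'
  · exact absurd (hL.lt b a h') (by rw [h]; exact lt_irrefl _)

lemma rowExp_eq_sum (hL : IsSympRow r L) :
    rowExp r L =
      ∑ a, Finsupp.single (L.get a, (⟨a.val, a.isLt.trans_le hL.length_le⟩ : Fin r)) 1 := by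
  classical
  ext ⟨i, t⟩
  rw [rowExp_apply, Finsupp.finsetSum_apply]
  simp only [Finsupp.single_apply, Prod.mk.injEq]
  split_ifs with h
  · obtain ⟨ht, h⟩ := List.getElem?_eq_some_iff.mp h
    rw [Finset.sum_eq_single ⟨t.val, ht⟩]
    · rw [if_pos ⟨h, rfl⟩]
    · rintro a - hne
      rw [if_neg]
      rintro ⟨-, rfl⟩
      exact hne rfl
    · simp
  · symm
    refine Finset.sum_eq_zero fun a _ => if_neg ?_
    rintro ⟨h1, rfl⟩
    exact h (by simp [← h1])

lemma exists_of_mem_support_pf (hL : IsSympRow r L) {e : Fin (2 * r) × Fin r →₀ ℕ}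
    (he : e ∈ (listPf (wedge (frame r (X (R := ℤ)))) L).support) :
    ∃ ψ : Fin L.length → Fin r, Function.Injective ψ ∧
      e = ∑ a, Finsupp.single (L.get a, ψ a) 1 := by
  classical
  rw [listPf_wedge] at he
  set B := (frame r (X (R := ℤ))).submatrix L.get id with hB
  have h1 := card_smul_pf_eq_sum hL.even (wedge B) fun i j => by
    simpa using congrFun (congrFun (wedge_skew B) j) i
  have h2 : coeff e (∑ σ, pfTerm hL.even (wedge B) σ) ≠ 0 := by
    rw [← h1, coeff_smul]
    exact smul_ne_zero Fintype.card_ne_zero (mem_support_iff.mp he)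
  rw [wedge, sum_pfTerm_mul_mul_transpose, coeff_sum] at h2
  obtain ⟨φ, -, h3⟩ := Finset.exists_ne_zero_of_sum_ne_zero h2
  have hK (s t : Fin r) : (pairMatrix r (MvPolynomial (Fin (2 * r) × Fin r) ℤ) -
      (pairMatrix r (MvPolynomial (Fin (2 * r) × Fin r) ℤ))ᵀ) s t =
      C ((pairMatrix r ℤ - (pairMatrix r ℤ)ᵀ) s t) := by
    rw [← pairMatrix_map r (C : ℤ →+* MvPolynomial (Fin (2 * r) × Fin r) ℤ)]
    simp
  simp only [hK, ← map_prod] at h3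
  rw [coeff_C_mul] at h3
  replace h3 := right_ne_zero_of_mul h3
  have hφ : Function.Injective φ := by
    intro a b hab
    by_contra hne
    refine h3 ?_
    rw [Matrix.det_zero_of_column_eq hne fun k => by simp [hab], coeff_zero]
  rw [Matrix.det_apply, coeff_sum] at h3
  obtain ⟨σ, -, h4⟩ := Finset.exists_ne_zero_of_sum_ne_zero h3
  rw [Units.smul_def, coeff_smul] at h4
  replace h4 := right_ne_zero_of_smul h4
  refine ⟨φ ∘ ⇑σ⁻¹, hφ.comp (σ⁻¹).injective, ?_⟩
  have h5 : ∏ a, B.submatrix id φ (σ a) a =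
      monomial (∑ a, Finsupp.single (L.get (σ a), φ a) 1) 1 := by
    rw [monomial_sum_one]
    refine Finset.prod_congr rfl fun a _ => ?_
    have : B.submatrix id φ (σ a) a ≠ 0 := fun h => h4 (by
      rw [Finset.prod_eq_zero (f := fun a => B.submatrix id φ (σ a) a) (Finset.mem_univ a) h,
        coeff_zero])
    simp only [hB, Matrix.submatrix_apply, frame, Matrix.of_apply, id] at this ⊢
    split_ifs at this ⊢ with h6
    · rfl
    · exact absurd rfl this
  rw [h5, coeff_monomial] at h4
  rw [← of_not_not fun h => h4 (if_neg h),
    ← Equiv.sum_comp σ fun a => Finsupp.single (L.get a, (φ ∘ ⇑σ⁻¹) a) 1]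
  simp

lemma lexWeight_sum_single (i : Fin L.length → Fin (2 * r)) (ψ : Fin L.length → Fin r) (k : ℕ) :
    ofLex (lexWeight r (∑ a, Finsupp.single (i a, ψ a) 1)) k =
      ∑ a, if ordIdx r (i a) = k then (ψ a).val else 0 := by
  have h : lexWeight r (∑ a, Finsupp.single (i a, ψ a) 1) =
      toLex (∑ a, (Pi.single (ordIdx r (i a)) (ψ a).val : ℕ → ℕ)) := by
    rw [map_sum]
    have h1 (p : Fin (2 * r) × Fin r) : lexWeight r (Finsupp.single p 1) =
        toLex (Pi.single (ordIdx r p.1) p.2.val : ℕ → ℕ) :=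
      (Finsupp.weight_single _ _ _).trans (one_nsmul _)
    simp only [h1]
    rfl
  rw [h, ofLex_toLex, Finset.sum_apply]
  simp only [Pi.single_apply, eq_comm]

lemma lexWeight_lt (hL : IsSympRow r L) {ψ : Fin L.length → Fin r} (hψ : Function.Injective ψ)
    (hne : ∃ a, (ψ a).val ≠ a.val) :
    lexWeight r (rowExp r L) < lexWeight r (∑ a, Finsupp.single (L.get a, ψ a) 1) := by
  classical
  obtain ⟨a, ha, hmin⟩ := WellFounded.has_min (wellFounded_lt (α := Fin L.length))
    {a | (ψ a).val ≠ a.val} hne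
  replace hmin (b : Fin L.length) (hb : b < a) : (ψ b).val = b.val := by
    by_contra h
    exact hmin b h hb
  have hlt : a.val < (ψ a).val := by
    refine lt_of_le_of_ne (le_of_not_gt fun h => ha ?_) (Ne.symm ha)
    have h1 := hmin ⟨(ψ a).val, h.trans a.isLt⟩ h
    exact congrArg Fin.val (hψ (Fin.ext h1))
  rw [rowExp_eq_sum hL]
  refine ⟨ordIdx r (L.get a), fun k hk => ?_, ?_⟩
  · change ofLex (lexWeight r _) k = ofLex (lexWeight r _) k
    rw [lexWeight_sum_single, lexWeight_sum_single]
    refine Finset.sum_congr rfl fun b _ => ?_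
    split_ifs with h
    · refine (hmin b ?_).symm
      by_contra! h'
      rcases h'.eq_or_lt with rfl | h'
      · exact hk.ne' h
      · exact absurd (hL.lt _ _ h') (by rw [h]; exact hk.asymm)
    · rfl
  · change ofLex (lexWeight r _) _ < ofLex (lexWeight r _) _
    rw [lexWeight_sum_single, lexWeight_sum_single]
    have h1 (f : Fin L.length → ℕ) :
        (∑ b, if ordIdx r (L.get b) = ordIdx r (L.get a) then f b else 0) = f a := by
      rw [Finset.sum_eq_single a]
      · rw [if_pos rfl]
      · intro b _ hb
        refine if_neg fun h => ?_
        rcases lt_or_gt_of_ne hb with h' | h'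
        · exact (hL.lt _ _ h').ne h
        · exact (hL.lt _ _ h').ne' h
      · simp
    rw [h1, h1]
    exact hlt

lemma coeff_rowExp_listPf (hL : IsSympRow r L) :
    (listPf (wedge (frame r (X (R := ℤ)))) L).coeff (rowExp r L) = 1 := by
  classical
  set p := listPf (wedge (frame r (X (R := ℤ)))) L with hp
  let v : Fin (2 * r) × Fin r → ℤ := fun q => rowExp r L q
  have hv (i : Fin L.length) (t : Fin r) : v (L.get i, t) = if t.val = i.val then 1 else 0 := by
    simp only [v, rowExp_apply]
    by_cases h : t.val = i.val
    · simp [h]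
    · rw [if_neg h, if_neg, Nat.cast_zero]
      intro h'
      obtain ⟨ht, h'⟩ := List.getElem?_eq_some_iff.mp h'
      exact h (congrArg Fin.val (hL.get_injective (a₁ := ⟨t.val, ht⟩) h'))
  have h1 : eval v p = 1 := by
    rw [hp, map_listPf, wedge_map, frame_map, listPf_wedge, ← pf_pairMatrix hL.even]
    congr 1
    ext a b
    have h3 (a : Fin L.length) (t : Fin r) :
        ((frame r (⇑(eval v) ∘ X)).submatrix L.get id) a t = if t.val = a.val then 1 else 0 := by
      simp only [Matrix.submatrix_apply, frame, Matrix.of_apply, id, Function.comp, eval_X, hv]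
      split_ifs with h4 h5 h5
      · rfl
      · rfl
      · exact absurd (h5 ▸ hL.le a) h4
      · rfl
    have h4 (a : Fin L.length) (f : Fin r → ℤ) :
        ∑ t, (if t.val = a.val then 1 else 0) * f t = f ⟨a.val, a.isLt.trans_le hL.length_le⟩ := by
      rw [Finset.sum_eq_single ⟨a.val, a.isLt.trans_le hL.length_le⟩]
      · simp
      · intro t _ ht
        rw [if_neg fun h => ht (Fin.ext h), zero_mul]
      · simp
    rw [wedge, Matrix.mul_apply]
    simp only [Matrix.transpose_apply, h3]
    simp only [mul_comm _ (ite _ _ _)]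
    rw [h4, Matrix.mul_apply]
    simp only [h3]
    rw [h4]
    rfl
  rw [eval_eq, Finset.sum_eq_single (rowExp r L)] at h1
  · rw [← h1, Finset.prod_eq_one, mul_one]
    rintro ⟨i, t⟩ hq
    have : v (i, t) = 1 := by
      rw [Finsupp.mem_support_iff, rowExp_apply] at hq
      simp only [v, rowExp_apply]
      rw [if_pos (by_contra fun h => hq (if_neg h)), Nat.cast_one]
    rw [this, one_pow]
  · intro e he hne
    obtain ⟨ψ, hψ, rfl⟩ := exists_of_mem_support_pf hL he
    obtain ⟨a, ha⟩ : ∃ a, (ψ a).val ≠ a.val := by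
      by_contra! h
      refine hne ?_
      rw [rowExp_eq_sum hL]
      exact Finset.sum_congr rfl fun a _ => congrArg (fun t => Finsupp.single (L.get a, t) 1) (Fin.ext (h a))
    have hmem : (L.get a, ψ a) ∈ (∑ a, Finsupp.single (L.get a, ψ a) 1).support := by
      rw [Finsupp.mem_support_iff, Finsupp.finsetSum_apply]
      refine (Finset.sum_pos' (fun _ _ => Nat.zero_le _) ⟨a, Finset.mem_univ a, ?_⟩).ne'
      simp
    rw [Finset.prod_eq_zero hmem, mul_zero]
    rw [hv, if_neg ha]
    exact zero_pow (Finsupp.mem_support_iff.mp hmem)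
  · intro h
    rw [notMem_support_iff.mp h, zero_mul]

lemma isInitial_listPf (hL : IsSympRow r L) (R : Type*) [CommRing R] :
    IsInitial (lexWeight r) (rowExp r L) (listPf (wedge (frame r (X (R := R)))) L) := by
  have h : IsInitial (lexWeight r) (rowExp r L) (listPf (wedge (frame r (X (R := ℤ)))) L) := by
    refine ⟨coeff_rowExp_listPf hL, fun e he => ?_⟩
    obtain ⟨ψ, hψ, rfl⟩ := exists_of_mem_support_pf hL he
    by_cases hne : ∃ a, (ψ a).val ≠ a.val
    · exact Or.inr (lexWeight_lt hL hψ hne)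
    · push Not at hne
      rw [rowExp_eq_sum hL]
      exact Or.inl (Finset.sum_congr rfl fun a _ => congrArg (fun t => Finsupp.single (L.get a, t) 1) (Fin.ext (hne a)))
  have h' := h.map (Int.castRingHom R)
  rw [map_listPf, wedge_map, frame_map] at h'
  convert h' using 4
  funext q
  simp

end Frame

section IsotropicFrame

open Polynomial

variable {r : ℕ} {A : Type*} [Field A] (x : Fin (2 * r) × Fin r → A)

lemma sum_fin_two_mul {M : Type*} [AddCommMonoid M] (f : Fin (2 * r) → M) :
    ∑ i, f i = ∑ p, f (emb r p) + ∑ p, f (embBar r p) := by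
  rw [← (finSumFinEquiv.trans (finCongr (two_mul r).symm)).sum_comp, Fintype.sum_sum_type]
  rfl

/-- The transpose of the rows `p̄` of the matrix `frame r x`. -/
def barRows : Matrix (Fin r) (Fin r) A :=
  Matrix.of fun s p => if s ≤ p then x (embBar r p, s) else 0

/-- A symmetric matrix whose product with `(barRows x)⁻¹` gives the upper half of an isotropic
frame degenerating to `frame r x`. -/
def symmPart : Matrix (Fin r) (Fin r) A[X] :=
  Matrix.of fun q t => X ^ (max q t).val *
    C (x (embBar r (max q t), max q t) * x (emb r (max q t), min q t))

/-- The isotropic frame over `A[X]` degenerating to `frame r x`, with the row of index `p < r`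
divided by `X ^ p`. -/
def scaledFrame : Matrix (Fin (2 * r)) (Fin r) A[X] :=
  Matrix.of fun i t => if h : i.val < r then
    ∑ q, C ((barRows x)⁻¹ ⟨i.val, h⟩ q) * (X ^ ((max q t).val - i.val) *
      C (x (embBar r (max q t), max q t) * x (emb r (max q t), min q t)))
  else C (frame r x i t)

/-- The power of the degeneration parameter by which a row of `scaledFrame` is multiplied. -/
def rowDeg (r : ℕ) (i : Fin (2 * r)) : ℕ := if i.val < r then i.val else 0

/-- The isotropic frame over `A[X]` degenerating, up to scaling of the rows, to `frame r x`. -/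
def isoFrame : Matrix (Fin (2 * r)) (Fin r) A[X] :=
  Matrix.of fun i t => X ^ rowDeg r i * scaledFrame x i t

variable {x}

lemma isUpperTriangular_barRows : (barRows x).IsUpperTriangular := by
  intro s p h
  exact if_neg (not_le.mpr h)

lemma isUnit_det_barRows (hx : ∀ p, x (embBar r p, p) ≠ 0) : IsUnit (barRows x).det := by
  rw [Matrix.det_of_isUpperTriangular isUpperTriangular_barRows, isUnit_iff_ne_zero,
    Finset.prod_ne_zero_iff]
  intro p _
  simpa [barRows] using hx p

lemma barRows_inv_apply_of_lt (hx : ∀ p, x (embBar r p, p) ≠ 0) {p q : Fin r} (h : q < p) :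
    (barRows x)⁻¹ p q = 0 := by
  let _ := (barRows x).invertibleOfIsUnitDet (isUnit_det_barRows hx)
  exact Matrix.blockTriangular_inv_of_blockTriangular isUpperTriangular_barRows h

lemma barRows_inv_apply_self (hx : ∀ p, x (embBar r p, p) ≠ 0) (p : Fin r) :
    (barRows x)⁻¹ p p * x (embBar r p, p) = 1 := by
  have h := congrFun (congrFun (Matrix.nonsing_inv_mul _ (isUnit_det_barRows hx)) p) p
  rw [Matrix.mul_apply, Finset.sum_eq_single p] at h
  · simpa [barRows] using h
  · intro q _ hq
    rcases lt_or_gt_of_ne hq with h' | h'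
    · rw [barRows_inv_apply_of_lt hx h', zero_mul]
    · rw [isUpperTriangular_barRows h', mul_zero]
  · simp

lemma isoFrame_embBar (p t : Fin r) :
    isoFrame x (embBar r p) t = C (barRows x t p) := by
  have h : ¬ (embBar r p).val < r := by simp [embBar]
  have h' : foldIdx r (embBar r p) = p.val := by
    rw [foldIdx, if_neg h]
    simp [embBar]
  simp only [isoFrame, rowDeg, scaledFrame, Matrix.of_apply, dif_neg h, if_neg h, pow_zero,
    one_mul, frame, barRows, h', Fin.le_def]

lemma isoFrame_emb (hx : ∀ p, x (embBar r p, p) ≠ 0) (p t : Fin r) :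
    isoFrame x (emb r p) t = (((barRows x)⁻¹).map C * symmPart x) p t := by
  simp only [isoFrame, rowDeg, scaledFrame, emb, Matrix.of_apply, p.isLt, dif_pos, if_true,
    Matrix.mul_apply, Matrix.map_apply, symmPart, Finset.mul_sum]
  refine Finset.sum_congr rfl fun q _ => ?_
  rcases lt_or_ge q p with h | h
  · simp [barRows_inv_apply_of_lt hx h]
  · have h1 : p.val + ((max q t).val - p.val) = (max q t).val :=
      Nat.add_sub_cancel' (h.trans (le_max_left q t))
    rw [mul_left_comm, ← mul_assoc (X ^ _) (X ^ _), ← pow_add, h1]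

lemma coeff_zero_scaledFrame (hx : ∀ p, x (embBar r p, p) ≠ 0) (i : Fin (2 * r)) (t : Fin r) :
    (scaledFrame x i t).coeff 0 = frame r x i t := by
  simp only [scaledFrame, Matrix.of_apply]
  split_ifs with hi
  · rw [finsetSum_coeff, Finset.sum_eq_single ⟨i.val, hi⟩]
    · simp only [frame, Matrix.of_apply, foldIdx, if_pos hi, coeff_C_mul, coeff_X_pow_mul']
      rcases le_or_gt t ⟨i.val, hi⟩ with h | h
      · rw [max_eq_left h, min_eq_right h, if_pos (by simp), if_pos (by exact h), Nat.zero_sub,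
          coeff_C_zero, ← mul_assoc, barRows_inv_apply_self hx, one_mul]
        rfl
      · rw [if_neg, if_neg, mul_zero]
        · exact not_le.mpr h
        · rw [max_eq_right h.le]
          have : i.val < t.val := h
          omega
    · intro q _ hq
      rcases lt_or_gt_of_ne hq with h | h
      · rw [barRows_inv_apply_of_lt hx h, C_0, zero_mul, coeff_zero]
      · rw [coeff_C_mul, coeff_X_pow_mul', if_neg, mul_zero]
        have h1 : q.val ≤ (max q t).val := le_max_left q t
        have h2 : i.val < q.val := h
        omega
    · simp
  · exact coeff_C_zero

lemma isoFrame_isotropic (hx : ∀ p, x (embBar r p, p) ≠ 0) :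
    (isoFrame x)ᵀ * Jmat r A[X] * isoFrame x = 0 := by
  have hsymm (s t : Fin r) : symmPart x s t = symmPart x t s := by
    simp only [symmPart, Matrix.of_apply]
    rw [max_comm, min_comm]
  have hkey (s t : Fin r) :
      ∑ p, isoFrame x (embBar r p) s * isoFrame x (emb r p) t = symmPart x s t := by
    have h1 : (barRows x).map C * (((barRows x)⁻¹).map C * symmPart x) = symmPart x := by
      rw [← Matrix.mul_assoc, ← Matrix.map_mul, Matrix.mul_nonsing_inv _ (isUnit_det_barRows hx),
        Matrix.map_one _ C_0 C_1, Matrix.one_mul]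
    conv_rhs => rw [← h1, Matrix.mul_apply]
    exact Finset.sum_congr rfl fun p _ => by
      rw [isoFrame_embBar, isoFrame_emb hx, Matrix.map_apply]
  have hJ1 (p q : Fin r) : Jmat r A[X] (emb r p) (emb r q) = 0 := by
    simp only [Jmat, emb, Matrix.of_apply]
    rw [if_neg (by omega), if_neg (by omega)]
  have hJ2 (p q : Fin r) : Jmat r A[X] (embBar r p) (embBar r q) = 0 := by
    simp only [Jmat, embBar, Matrix.of_apply]
    rw [if_neg (by omega), if_neg (by omega)]
  have hJ3 (p q : Fin r) : Jmat r A[X] (emb r p) (embBar r q) = if p = q then 1 else 0 := by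
    simp only [Jmat, emb, embBar, Matrix.of_apply, Fin.ext_iff]
    rw [if_neg (c := p.val = r + q.val + r) (by omega)]
    exact if_congr (by omega) rfl rfl
  have hJ4 (p q : Fin r) : Jmat r A[X] (embBar r p) (emb r q) = if p = q then -1 else 0 := by
    simp only [Jmat, emb, embBar, Matrix.of_apply, Fin.ext_iff]
    rw [if_neg (by omega)]
    exact if_congr (by omega) rfl rfl
  ext s t : 2
  rw [Matrix.mul_apply, sum_fin_two_mul]
  simp only [Matrix.mul_apply, Matrix.transpose_apply, sum_fin_two_mul, hJ1, hJ2, hJ3, hJ4,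
    mul_ite, mul_zero, Finset.sum_const_zero, zero_add, add_zero, Finset.sum_ite_eq',
    Finset.mem_univ, if_true, mul_one, mul_neg, neg_mul, Finset.sum_neg_distrib, hkey]
  rw [hsymm s t, ← hkey t s]
  simp [mul_comm]

lemma exists_algHom_FV (F : Type*) [Field F] [Algebra F A] (hx : ∀ p, x (embBar r p, p) ≠ 0) :
    ∃ Φ : FV r F →ₐ[F] A[X], ∀ T, Φ (tabElem r F T) = (T.map (listPf (wedge (isoFrame x)))).prod := by
  set Y := wedge (isoFrame x) with hY
  let f : PolyRing r F →ₐ[F] A[X] := MvPolynomial.aeval fun p => Y p.1 p.2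
  have hYgen : (Ygen r F).map f = Y := by
    ext i j : 2
    simp [Ygen, f]
  have hJ : (Jmat r (PolyRing r F)).map f = Jmat r A[X] := by
    ext i j : 2
    simp [Jmat, apply_ite f]
  have hYJY : Yᵀ * Jmat r A[X] * Y = 0 := by
    have h : Yᵀ * Jmat r A[X] * Y =
        isoFrame x * (pairMatrix r A[X] - (pairMatrix r A[X])ᵀ)ᵀ *
          ((isoFrame x)ᵀ * Jmat r A[X] * isoFrame x) *
          ((pairMatrix r A[X] - (pairMatrix r A[X])ᵀ) * (isoFrame x)ᵀ) := by
      simp only [hY, wedge, Matrix.transpose_mul, Matrix.transpose_transpose, Matrix.mul_assoc]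
    rw [h, isoFrame_isotropic hx, Matrix.mul_zero, Matrix.zero_mul]
  have hchar : Matrix.charpoly (-(Jmat r A[X] * Y)) = X ^ (2 * r) := by
    have h0 : Y * (Jmat r A[X] * Y) = 0 := by
      rw [wedge_skew, ← hY, Matrix.neg_mul, Matrix.neg_mul, neg_eq_zero, Matrix.mul_assoc] at hYJY
      exact hYJY
    have h1 : IsNilpotent (-(Jmat r A[X] * Y)) :=
      ⟨2, by rw [sq, neg_mul_neg, Matrix.mul_assoc, h0, Matrix.mul_zero]⟩
    have h2 := (Matrix.isNilpotent_charpoly_sub_pow_of_isNilpotent h1).eq_zero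
    rwa [Fintype.card_fin, sub_eq_zero] at h2
  have hker : ∀ a ∈ VIdeal r F, f a = 0 := by
    intro a ha
    have hle : VIdeal r F ≤ RingHom.ker f := by
      refine Ideal.span_le.mpr ?_
      rintro p (((⟨i, j, rfl⟩ | ⟨i, rfl⟩) | ⟨i, j, rfl⟩) | ⟨k, rfl⟩)
      · change f _ = 0
        have h := congrFun (congrFun hYgen i) j
        have h' := congrFun (congrFun hYgen j) i
        have h'' := congrFun (congrFun (wedge_skew (isoFrame x)) i) j
        simp only [Matrix.map_apply, Matrix.transpose_apply, Matrix.neg_apply, ← hY] at h h' h''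
        rw [Matrix.add_apply, Matrix.transpose_apply, map_add, h, h', h'']
        exact add_neg_cancel _
      · exact (congrFun (congrFun hYgen i) i).trans (wedge_diag _ i)
      · have h : ((Ygen r F)ᵀ * Jmat r (PolyRing r F) * Ygen r F).map f = 0 := by
          rw [Matrix.map_mul, Matrix.map_mul, Matrix.transpose_map, hYgen, hJ, hYJY]
        exact congrFun (congrFun h i) j
      · change f _ = 0
        have h : (-(Jmat r (PolyRing r F) * Ygen r F)).map f.toRingHom = -(Jmat r A[X] * Y) := by
          rw [Matrix.map_neg f.toRingHom (map_neg _), Matrix.map_mul]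
          exact congrArg₂ (fun P Q => -(P * Q)) hJ hYgen
        have h2 := congrArg (fun p => p.coeff k) (Matrix.charpoly_map
          (-(Jmat r (PolyRing r F) * Ygen r F)) f.toRingHom)
        simp only [h, hchar, Polynomial.coeff_map] at h2
        rw [Polynomial.coeff_sub, map_sub, sub_eq_zero]
        refine h2.symm.trans ?_
        rw [Polynomial.coeff_X_pow, Polynomial.coeff_X_pow, apply_ite f, map_one, map_zero]
    exact hle ha
  refine ⟨Ideal.Quotient.liftₐ (VIdeal r F) f hker, fun T => ?_⟩
  have h1 : Ideal.Quotient.liftₐ (VIdeal r F) f hker (tabElem r F T) = f (tabPoly r F T) := rfl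
  rw [h1, tabPoly, map_list_prod, List.map_map]
  congr 2
  funext L
  have h2 := map_listPf (f : PolyRing r F →+* A[X]) (Ygen r F) L
  exact h2.trans (congrArg (fun M => listPf M L) hYgen)

lemma listPf_wedge_isoFrame {L : List (Fin (2 * r))} (hL : L.length / 2 * 2 = L.length) :
    listPf (wedge (isoFrame x)) L =
      X ^ (L.map (rowDeg r)).sum * listPf (wedge (scaledFrame x)) L := by
  have h : isoFrame x = Matrix.diagonal (fun i => (X : A[X]) ^ rowDeg r i) * scaledFrame x := by
    ext i t : 2
    simp [isoFrame]
  have h1 (i j : Fin (2 * r)) : wedge (isoFrame x) i j =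
      X ^ rowDeg r i * X ^ rowDeg r j * wedge (scaledFrame x) i j := by
    have h2 : wedge (isoFrame x) = Matrix.diagonal (fun i => (X : A[X]) ^ rowDeg r i) *
        wedge (scaledFrame x) * Matrix.diagonal (fun i => (X : A[X]) ^ rowDeg r i) := by
      rw [h, wedge, wedge, Matrix.transpose_mul, Matrix.diagonal_transpose]
      simp only [Matrix.mul_assoc]
    rw [h2, Matrix.mul_diagonal, Matrix.diagonal_mul]
    ring
  have h3 : listPf (wedge (isoFrame x)) L =
      (∏ a, (X : A[X]) ^ rowDeg r (L.get a)) * listPf (wedge (scaledFrame x)) L := by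
    rw [listPf, listPf, ← pf_smul_smul hL]
    exact congrArg pf (Matrix.ext fun a b => h1 _ _)
  rw [h3, Finset.prod_pow_eq_pow_sum]
  congr 2
  simp

end IsotropicFrame

section Tableaux

variable {r : ℕ}

lemma ordIdx_injective (r : ℕ) : Function.Injective (ordIdx r) := by
  intro i j h
  simp only [ordIdx] at h
  split_ifs at h <;> exact Fin.ext (by omega)

/-- The row `L` is at least as long as `L'`, with entries at most those of `L'`. -/
def RowLE (r : ℕ) (L L' : List (Fin (2 * r))) : Prop :=
  ∀ (t : ℕ) (i : Fin (2 * r)), L'[t]? = some i → ∃ j, L[t]? = some j ∧ ordIdx r j ≤ ordIdx r i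

lemma RowLE.refl (L : List (Fin (2 * r))) : RowLE r L L := fun _ i h => ⟨i, h, le_rfl⟩

instance : IsTrans (List (Fin (2 * r))) (RowLE r) where
  trans _ _ _ h₁ h₂ t i hi := by
    obtain ⟨j, hj, hji⟩ := h₂ t i hi
    obtain ⟨k, hk, hkj⟩ := h₁ t j hj
    exact ⟨k, hk, hkj.trans hji⟩

lemma IsSSET.pairwise_rowLE {T : List (List (Fin (2 * r)))} (hT : IsSSET r T) :
    T.Pairwise (RowLE r) := by
  obtain ⟨⟨hlen, -⟩, -, ⟨-, hcol⟩, -⟩ := hT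
  replace hlen : List.IsChain _ _ := hlen
  rw [List.isChain_map, List.isChain_iff_getElem] at hlen
  rw [← List.isChain_iff_pairwise, List.isChain_iff_getElem]
  intro k hk t i hi
  obtain ⟨ht, rfl⟩ := List.getElem?_eq_some_iff.mp hi
  have ht' := ht.trans_le (hlen k hk)
  exact ⟨_, List.getElem?_eq_getElem ht', hcol k t hk ht' ht⟩

lemma IsSSET.isSympRow {T : List (List (Fin (2 * r)))} (hT : IsSSET r T)
    {L : List (Fin (2 * r))} (hL : L ∈ T) : IsSympRow r L := by
  obtain ⟨-, heven, ⟨hrow, -⟩, hsymp⟩ := hT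
  refine ⟨Nat.div_mul_cancel (heven L hL).two_dvd, fun a b hab => ?_, fun a => ?_⟩
  · have h : List.IsChain _ _ := hrow L hL
    have : IsTrans (Fin (2 * r)) fun a b => ordIdx r a < ordIdx r b := ⟨fun _ _ _ => lt_trans⟩
    exact List.pairwise_iff_get.mp (List.isChain_iff_pairwise.mp h) a b hab
  · obtain ⟨k, hk, rfl⟩ := List.getElem_of_mem hL
    refine hsymp k a hk a.isLt _ (foldIdx_lt _) ?_
    rw [← List.get_eq_getElem, foldIdx]
    split_ifs <;> omega

lemma list_sum_rowExp_ne_zero_iff (T : List (List (Fin (2 * r)))) (i : Fin (2 * r)) (t : Fin r) :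
    (T.map (rowExp r)).sum (i, t) ≠ 0 ↔ ∃ L ∈ T, L[t.val]? = some i := by
  induction T with
  | nil => simp
  | cons L T ih =>
    rw [List.map_cons, List.sum_cons, Finsupp.add_apply, rowExp_apply, ne_eq, Nat.add_eq_zero_iff,
      not_and_or, ← ne_eq ((T.map (rowExp r)).sum (i, t)), ih]
    simp

lemma eq_of_rowLE {L M : List (Fin (2 * r))} {T S : List (List (Fin (2 * r)))}
    (hL : ∀ L' ∈ L :: T, RowLE r L L') (hM : ∀ M' ∈ M :: S, RowLE r M M')
    (h : ∀ (t : ℕ) (i : Fin (2 * r)),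
      (∃ L' ∈ L :: T, L'[t]? = some i) ↔ ∃ M' ∈ M :: S, M'[t]? = some i) : L = M := by
  have key {L M : List (Fin (2 * r))} {T S : List (List (Fin (2 * r)))}
      (hL : ∀ L' ∈ L :: T, RowLE r L L') (hM : ∀ M' ∈ M :: S, RowLE r M M')
      (h : ∀ (t : ℕ) (i : Fin (2 * r)),
        (∃ L' ∈ L :: T, L'[t]? = some i) ↔ ∃ M' ∈ M :: S, M'[t]? = some i)
      (t : ℕ) (i : Fin (2 * r)) (hi : L[t]? = some i) : M[t]? = some i := by
    obtain ⟨M', hM', hi'⟩ := (h t i).mp ⟨L, List.mem_cons_self, hi⟩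
    obtain ⟨j, hj, hji⟩ := hM M' hM' t i hi'
    obtain ⟨L', hL', hj'⟩ := (h t j).mpr ⟨M, List.mem_cons_self, hj⟩
    obtain ⟨k, hk, hkj⟩ := hL L' hL' t j hj'
    obtain rfl : i = k := Option.some_injective _ (hi.symm.trans hk)
    rwa [ordIdx_injective r (le_antisymm hkj hji)]
  exact List.ext_getElem? fun t => Option.ext fun i =>
    ⟨key hL hM h t i, key hM hL (fun t i => (h t i).symm) t i⟩

lemma exists_getElem?_eq_some_iff_of_sum_rowExp_eq {T S : List (List (Fin (2 * r)))}
    (hT₀ : ∀ L ∈ T, L ≠ [] ∧ L.length ≤ r) (hS₀ : ∀ L ∈ S, L ≠ [] ∧ L.length ≤ r)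
    (h : (T.map (rowExp r)).sum = (S.map (rowExp r)).sum) (t : ℕ) (i : Fin (2 * r)) :
    (∃ L ∈ T, L[t]? = some i) ↔ ∃ L ∈ S, L[t]? = some i := by
  rcases lt_or_ge t r with ht | ht
  · rw [← list_sum_rowExp_ne_zero_iff T i ⟨t, ht⟩, ← list_sum_rowExp_ne_zero_iff S i ⟨t, ht⟩, h]
  · have hnone {T : List (List (Fin (2 * r)))} (hT₀ : ∀ L ∈ T, L ≠ [] ∧ L.length ≤ r) :
        ¬ ∃ L ∈ T, L[t]? = some i := by
      rintro ⟨L, hL, hi⟩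
      rw [List.getElem?_eq_none ((hT₀ L hL).2.trans ht)] at hi
      simp at hi
    exact iff_of_false (hnone hT₀) (hnone hS₀)

lemma eq_of_sum_rowExp_eq {T S : List (List (Fin (2 * r)))}
    (hT : T.Pairwise (RowLE r)) (hS : S.Pairwise (RowLE r))
    (hT₀ : ∀ L ∈ T, L ≠ [] ∧ L.length ≤ r) (hS₀ : ∀ L ∈ S, L ≠ [] ∧ L.length ≤ r)
    (h : (T.map (rowExp r)).sum = (S.map (rowExp r)).sum) : T = S := by
  have hhead {L : List (Fin (2 * r))} {T : List (List (Fin (2 * r)))} (hL : L ≠ []) :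
      ∃ i, ∃ L' ∈ L :: T, L'[0]? = some i :=
    ⟨L[0]'(List.length_pos_iff.mpr hL), L, List.mem_cons_self, List.getElem?_eq_getElem _⟩
  induction T generalizing S with
  | nil =>
    cases S with
    | nil => rfl
    | cons M S =>
      obtain ⟨i, hi⟩ := hhead (T := S) (hS₀ M List.mem_cons_self).1
      simpa using (exists_getElem?_eq_some_iff_of_sum_rowExp_eq hT₀ hS₀ h 0 i).mpr hi
  | cons L T ih =>
    cases S with
    | nil =>
      obtain ⟨i, hi⟩ := hhead (T := T) (hT₀ L List.mem_cons_self).1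
      simpa using (exists_getElem?_eq_some_iff_of_sum_rowExp_eq hT₀ hS₀ h 0 i).mp hi
    | cons M S =>
      have hle {L : List (Fin (2 * r))} {T : List (List (Fin (2 * r)))}
          (hT : (L :: T).Pairwise (RowLE r)) : ∀ L' ∈ L :: T, RowLE r L L' :=
        List.forall_mem_cons.mpr ⟨RowLE.refl L, (List.pairwise_cons.mp hT).1⟩
      obtain rfl := eq_of_rowLE (hle hT) (hle hS)
        (exists_getElem?_eq_some_iff_of_sum_rowExp_eq hT₀ hS₀ h)
      rw [List.map_cons, List.map_cons, List.sum_cons, List.sum_cons, add_right_inj] at h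
      rw [ih hT.of_cons hS.of_cons (fun L hL => hT₀ L (List.mem_cons_of_mem _ hL))
        (fun L hL => hS₀ L (List.mem_cons_of_mem _ hL)) h]

lemma injective_sum_rowExp (r : ℕ) :
    Function.Injective fun T : {T : List (List (Fin (2 * r))) // IsSSET r T} =>
      (T.val.map (rowExp r)).sum := by
  intro T S h
  exact Subtype.ext <| eq_of_sum_rowExp_eq T.2.pairwise_rowLE S.2.pairwise_rowLE
    (fun L hL => ⟨T.2.1.2 L hL, (T.2.isSympRow hL).length_le⟩)
    (fun L hL => ⟨S.2.1.2 L hL, (S.2.isSympRow hL).length_le⟩) h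

end Tableaux

section LinearIndependence

open Polynomial

variable {r : ℕ}

/-- The product of the Pfaffians of `wedge (frame r X)` associated with the rows of `T`. -/
def framePoly (r : ℕ) (F : Type*) [Field F] (T : List (List (Fin (2 * r)))) :
    MvPolynomial (Fin (2 * r) × Fin r) F :=
  (T.map (listPf (wedge (frame r MvPolynomial.X)))).prod

lemma linearIndependent_framePoly (r : ℕ) (F : Type*) [Field F] :
    LinearIndependent F fun T : {T : List (List (Fin (2 * r))) // IsSSET r T} =>
      framePoly r F T.val :=
  linearIndependent_of_isInitial (W := lexWeight r) _ _ (injective_sum_rowExp r) fun T =>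
    IsInitial.list_prod _ _ _ fun _ hL => isInitial_listPf (T.2.isSympRow hL) F

variable {A : Type*} [Field A] {x : Fin (2 * r) × Fin r → A}

lemma coeff_zero_prod_scaledFrame (hx : ∀ p, x (embBar r p, p) ≠ 0)
    (T : List (List (Fin (2 * r)))) :
    (T.map (listPf (wedge (scaledFrame x)))).prod.coeff 0 =
      (T.map (listPf (wedge (frame r x)))).prod := by
  have h : (scaledFrame x).map constantCoeff = frame r x :=
    Matrix.ext (coeff_zero_scaledFrame hx)
  rw [← constantCoeff_apply, map_list_prod, List.map_map]
  congr 2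
  funext L
  rw [Function.comp_apply, map_listPf, wedge_map, h]

lemma prod_isoFrame {T : List (List (Fin (2 * r)))}
    (hT : ∀ L ∈ T, L.length / 2 * 2 = L.length) :
    (T.map (listPf (wedge (isoFrame x)))).prod =
      X ^ (T.map fun L => (L.map (rowDeg r)).sum).sum *
        (T.map (listPf (wedge (scaledFrame x)))).prod := by
  induction T with
  | nil => simp
  | cons L T ih =>
    rw [List.forall_mem_cons] at hT
    simp only [List.map_cons, List.prod_cons, List.sum_cons, ih hT.2,
      listPf_wedge_isoFrame hT.1, pow_add]
    ring

lemma algebraMap_framePoly {F : Type*} [Field F]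
    [Algebra (MvPolynomial (Fin (2 * r) × Fin r) F) A]
    (T : List (List (Fin (2 * r)))) :
    algebraMap (MvPolynomial (Fin (2 * r) × Fin r) F) A (framePoly r F T) =
      (T.map (listPf (wedge (frame r fun p =>
        algebraMap (MvPolynomial (Fin (2 * r) × Fin r) F) A (MvPolynomial.X p))))).prod := by
  rw [framePoly, map_list_prod, List.map_map]
  congr 2
  funext L
  rw [Function.comp_apply, map_listPf, wedge_map, frame_map]
  rfl

lemma linearIndependent_tabElem (r : ℕ) (F : Type*) [Field F] :
    LinearIndependent F fun T : {T : List (List (Fin (2 * r))) // IsSSET r T} =>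
      tabElem r F T.val := by
  let P := MvPolynomial (Fin (2 * r) × Fin r) F
  have hinj : Function.Injective (algebraMap P (FractionRing P)) := IsFractionRing.injective _ _
  let x : Fin (2 * r) × Fin r → FractionRing P := fun p => algebraMap P _ (MvPolynomial.X p)
  have hx (p : Fin r) : x (embBar r p, p) ≠ 0 :=
    (map_ne_zero_iff _ hinj).mpr (MvPolynomial.X_ne_zero _)
  obtain ⟨Φ, hΦ⟩ := exists_algHom_FV F hx
  let ι := (IsScalarTower.toAlgHom F P (FractionRing P)).toLinearMap
  have hι : LinearMap.ker ι = ⊥ := LinearMap.ker_eq_bot.mpr hinj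
  have h := (linearIndependent_framePoly r F).map' ι hι
  let q (T : {T : List (List (Fin (2 * r))) // IsSSET r T}) :=
    (T.val.map (listPf (wedge (scaledFrame x)))).prod
  have hq : (fun T => (q T).coeff 0) = ι ∘ fun T => framePoly r F T.val := funext fun T =>
    (coeff_zero_prod_scaledFrame hx T.val).trans (algebraMap_framePoly T.val).symm
  have hΦq (T : {T : List (List (Fin (2 * r))) // IsSSET r T}) : Φ (tabElem r F T.val) =
      X ^ (T.val.map fun L => (L.map (rowDeg r)).sum).sum * q T :=
    (hΦ T.val).trans (prod_isoFrame fun L hL => (T.2.isSympRow hL).even)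
  refine LinearIndependent.of_comp Φ.toLinearMap ?_
  rw [show Φ.toLinearMap ∘ _ = _ from funext hΦq]
  exact linearIndependent_X_pow_mul q _ (hq ▸ h)

end LinearIndependence

/-- For `n = 2r ≥ 4` and any field `F`, the family `[T]`, indexed by the
symplectic standard even-tableaux `T`, is linearly independent over `F`; in particular
`T ↦ [T]` is injective. -/
theorem linearIndependent_FV_sset (r : ℕ) (hn : 4 ≤ 2 * r) (F : Type*) [Field F] :
    (LinearIndependent F fun T : {T : List (List (Fin (2 * r))) // IsSSET r T} =>
      tabElem r F T.val) ∧
    Function.Injective fun T : {T : List (List (Fin (2 * r))) // IsSSET r T} =>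
      tabElem r F T.val := by
  exact ⟨linearIndependent_tabElem r F, (linearIndependent_tabElem r F).injective⟩

end PR
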